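/- For every n ≥ 4, the graph H_n embeds in the Klein bottle as a quadrangulation: it has a 2-cell embedding in the Klein bottle in which every face is bounded by a 4-cycle. -/

import Mathlib

/-- Gallai's graph `H n`: the Cartesian product of the path on `Fin n` with the
triangle on `ZMod 3`, together with the three twist edges joining `(0, j)` to
`(n-1, -j)`. -/
def Hgraph (n : ℕ) : SimpleGraph (Fin n × ZMod 3) :=
  SimpleGraph.fromRel (fun x y =>
    (x.1 = y.1 ∧ x.2 ≠ y.2) ∨
    ((x.1 : ℕ) + 1 = (y.1 : ℕ) ∧ x.2 = y.2) ∨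
    ((x.1 : ℕ) = 0 ∧ (y.1 : ℕ) = n - 1 ∧ y.2 = -x.2))

/-- `G` is `k`-critical: `χ(G) = k` and deleting any vertex leaves a
`(k-1)`-colourable graph. -/
def SimpleGraph.IsCrit {V : Type} (G : SimpleGraph V) (k : ℕ) : Prop :=
  G.chromaticNumber = k ∧
    ∀ v : V, (SimpleGraph.induce {u | u ≠ v} G).Colorable (k - 1)

/-- A combinatorial 2-cell embedding of `G` into a closed surface, all of whose
faces are quadrilaterals: a family of facial closed walks `face f`, each
bounded by a 4-cycle of `G`, such that every edge of `G` lies on exactly two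
face-sides, and such that around every vertex the faces fit together into a
single umbrella (the link of every vertex is a single cycle).  These conditions
say precisely that gluing a 4-gon onto each facial walk yields a closed
surface in which `G` is 2-cell embedded with all faces 4-gons. -/
def IsQuadCellEmbedding {V : Type} [Fintype V] [DecidableEq V]
    (G : SimpleGraph V) (m : ℕ) (face : Fin m → Fin 4 → V) : Prop :=
  (∀ f : Fin m, ∀ k : Fin 4, G.Adj (face f k) (face f (k + 1))) ∧
  (∀ f : Fin m, Function.Injective (face f)) ∧
  (∀ a b : V, G.Adj a b →
    ({p : Fin m × Fin 4 |
        (face p.1 p.2 = a ∧ face p.1 (p.2 + 1) = b) ∨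
        (face p.1 p.2 = b ∧ face p.1 (p.2 + 1) = a)}).ncard = 2) ∧
  (∀ v : V,
    ((SimpleGraph.fromRel (fun u w =>
        ∃ (f : Fin m) (k : Fin 4), face f (k + 1) = v ∧
          face f k = u ∧ face f (k + 2) = w)).induce
      (G.neighborSet v)).Connected ∧
    ∀ u ∈ G.neighborSet v,
      ({w ∈ G.neighborSet v |
          ∃ (f : Fin m) (k : Fin 4), face f (k + 1) = v ∧
            ((face f k = u ∧ face f (k + 2) = w) ∨
             (face f k = w ∧ face f (k + 2) = u))}).ncard = 2)

/-- The embedding is orientable: the facial walks can be given directions so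
that every edge is traversed exactly once in each direction. -/
def IsOrientableEmbedding {V : Type} [Fintype V] [DecidableEq V]
    (G : SimpleGraph V) (m : ℕ) (face : Fin m → Fin 4 → V) : Prop :=
  ∃ ε : Fin m → Bool, ∀ a b : V, G.Adj a b →
    ({p : Fin m × Fin 4 |
        if ε p.1 then face p.1 p.2 = a ∧ face p.1 (p.2 + 1) = b
        else face p.1 p.2 = b ∧ face p.1 (p.2 + 1) = a}).ncard = 1

structure QSys (V : Type) where
  r : V → V
  s : V → V
  t : V → V
  r3 : ∀ v, r (r (r v)) = v
  st : ∀ v, s (t v) = v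
  ts : ∀ v, t (s v) = v
  com : ∀ v, s (r v) = r (s v) ∨ s (r v) = r (r (s v))
  r1 : ∀ v, r v ≠ v
  s0 : ∀ v, s v ≠ v
  s1 : ∀ v, s v ≠ r v
  s2 : ∀ v, s v ≠ r (r v)
  ss0 : ∀ v, s (s v) ≠ v
  ss1 : ∀ v, s (s v) ≠ r v
  ss2 : ∀ v, s (s v) ≠ r (r v)

namespace QSys
variable {V : Type} (Q : QSys V)

def face (v : V) : Fin 4 → V := ![v, Q.r v, Q.s (Q.r v), Q.s v]

@[simp] lemma face0 (v : V) : Q.face v 0 = v := rfl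
@[simp] lemma face1 (v : V) : Q.face v 1 = Q.r v := rfl
@[simp] lemma face2 (v : V) : Q.face v 2 = Q.s (Q.r v) := rfl
@[simp] lemma face3 (v : V) : Q.face v 3 = Q.s v := rfl

lemma fin4 (P : Fin 4 → Prop) : (∃ k, P k) ↔ P 0 ∨ P 1 ∨ P 2 ∨ P 3 := by
  simp [Fin.exists_fin_succ]

lemma r_inj {a b : V} (h : Q.r a = Q.r b) : a = b := by
  rw [← Q.r3 a, h, Q.r3]
lemma s_inj {a b : V} (h : Q.s a = Q.s b) : a = b := by
  rw [← Q.ts a, h, Q.ts]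

def A (a b : V) : Prop := b = Q.r a ∨ a = Q.r b ∨ b = Q.s a ∨ a = Q.s b

lemma rr1 (v : V) : Q.r (Q.r v) ≠ v := fun h => Q.r1 v (by
  have := Q.r3 v; rw [h] at this; exact this)
lemma rr2 (v : V) : Q.r (Q.r v) ≠ Q.r v := Q.r1 _

lemma face_adj (v : V) (k : Fin 4) : Q.A (Q.face v k) (Q.face v (k+1)) := by
  have := Q.com v
  have := Q.r3 (Q.s v)
  fin_cases k <;> simp [A] <;> grind

lemma face_inj (v : V) : Function.Injective (Q.face v) := by
  have h1 := Q.s0 v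
  have h2 := Q.s1 v
  have h4 := Q.r1 v
  have h5 := Q.s0 (Q.r v)
  have h6 := Q.s2 (Q.r v)
  have h7 := Q.r3 v
  have h8 : Q.s (Q.r v) ≠ Q.s v := fun h => h4 (Q.s_inj h)
  intro a b h
  fin_cases a <;> fin_cases b <;> simp at h ⊢ <;> grind

/-- the corner relation -/
def C (v u w : V) : Prop := ∃ f k, Q.face f (k+1) = v ∧
  ((Q.face f k = u ∧ Q.face f (k+2) = w) ∨ (Q.face f k = w ∧ Q.face f (k+2) = u))

lemma C_iff (v u w : V) : Q.C v u w ↔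
    ((u = Q.r v ∨ u = Q.r (Q.r v)) ∧ (w = Q.s v ∨ w = Q.t v)) ∨
    ((w = Q.r v ∨ w = Q.r (Q.r v)) ∧ (u = Q.s v ∨ u = Q.t v)) := by
  have e1 : ∀ f, Q.s (Q.r f) = v → Q.r f = Q.t v := fun f h => by rw [← h, Q.ts]
  have e2 : ∀ f, Q.s f = v → f = Q.t v := fun f h => by rw [← h, Q.ts]
  have e3 : ∀ f, Q.s (Q.r f) = v → Q.s f = Q.r v ∨ Q.s f = Q.r (Q.r v) := fun f h => by
    have := Q.com f
    have := Q.r3 (Q.s f)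
    grind
  have e4 : ∀ f, Q.s f = v → Q.s (Q.r f) = Q.r v ∨ Q.s (Q.r f) = Q.r (Q.r v) := fun f h => by
    have := Q.com f
    grind
  constructor
  · rintro ⟨f, k, h1, h2⟩
    have := e1 f
    have := e2 f
    have := e3 f
    have := e4 f
    have := Q.r3 f
    fin_cases k <;> simp at h1 h2 <;> grind
  · have key : ∀ u w, (u = Q.r v ∨ u = Q.r (Q.r v)) → (w = Q.s v ∨ w = Q.t v) → Q.C v u w := by
      intro u w hu hw
      rcases hw with rfl | rfl
      · rcases hu with rfl | rfl
        · exact ⟨v, 3, by simp, Or.inr (by simp)⟩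
        · exact ⟨Q.r (Q.r v), 0, by simp [Q.r3], Or.inl (by simp [Q.r3])⟩
      · have h3 := e4 (Q.t v) (Q.st v)
        have h4 := e3 (Q.r (Q.r (Q.t v))) (by simp [Q.r3, Q.st])
        have h5 : Q.s (Q.r (Q.t v)) ≠ Q.s (Q.r (Q.r (Q.t v))) := fun h =>
          Q.rr2 _ (Q.s_inj h).symm
        have h6 := Q.rr2 v
        by_cases h : u = Q.s (Q.r (Q.t v))
        · exact ⟨Q.t v, 2, by simp [Q.st], Or.inl (by simp [h])⟩
        · have : u = Q.s (Q.r (Q.r (Q.t v))) := by grind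
          exact ⟨Q.r (Q.r (Q.t v)), 1, by simp [Q.r3, Q.st], Or.inr (by simp [this, Q.r3])⟩
    rintro (⟨h1, h2⟩ | ⟨h1, h2⟩)
    · exact key u w h1 h2
    · obtain ⟨f, k, h, h'⟩ := key w u h1 h2
      exact ⟨f, k, h, h'.symm⟩

lemma A_iff (v u : V) : Q.A v u ↔ u = Q.r v ∨ u = Q.r (Q.r v) ∨ u = Q.s v ∨ u = Q.t v := by
  have := Q.r3 v
  have := Q.r3 u
  have := Q.st v
  have := Q.ts u
  unfold A
  grind

lemma tne (v : V) : Q.s v ≠ Q.t v := fun h => Q.ss0 v (by rw [h, Q.st])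

lemma C_ncard (v u : V) (hu : Q.A v u) : {w | Q.A v w ∧ Q.C v u w}.ncard = 2 := by
  have h1 := Q.s1 v
  have h2 := Q.s2 v
  have h3 : Q.t v ≠ Q.r v := fun h => Q.s2 (Q.r v) (by rw [← h, Q.st, h, Q.r3])
  have h4 : Q.t v ≠ Q.r (Q.r v) := fun h => Q.s1 (Q.r (Q.r v)) (by rw [← h, Q.st, h, Q.r3])
  have h5 := Q.rr2 v
  have h6 := Q.tne v
  simp only [C_iff]
  simp only [A_iff] at hu ⊢
  by_cases hc : u = Q.r v ∨ u = Q.r (Q.r v)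
  · rw [← Set.ncard_pair h6]
    congr 1; ext w
    simp only [Set.mem_ofPred_eq, Set.mem_insert_iff, Set.mem_singleton_iff]
    grind
  · rw [← Set.ncard_pair h5]
    congr 1; ext w
    simp only [Set.mem_ofPred_eq, Set.mem_insert_iff, Set.mem_singleton_iff]
    grind

lemma link_conn (v : V) (N : Set V) (hN : ∀ u, u ∈ N ↔ Q.A v u) (H : SimpleGraph V)
    (hH : ∀ u w, u ≠ w → Q.C v u w → H.Adj u w) : (H.induce N).Connected := by
  have h1 := Q.s1 v
  have h2 := Q.s2 v
  have h3 : Q.t v ≠ Q.r v := fun h => Q.s2 (Q.r v) (by rw [← h, Q.st, h, Q.r3])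
  have m1 : Q.s v ∈ N := by simp [hN, A_iff]
  have m2 : Q.r v ∈ N := by simp [hN, A_iff]
  have m3 : Q.r (Q.r v) ∈ N := by simp [hN, A_iff]
  have m4 : Q.t v ∈ N := by simp [hN, A_iff]
  have a1 : (H.induce N).Adj ⟨_, m2⟩ ⟨_, m1⟩ := hH _ _ h1.symm (by simp [C_iff])
  have a2 : (H.induce N).Adj ⟨_, m3⟩ ⟨_, m1⟩ := hH _ _ h2.symm (by simp [C_iff])
  have a3 : (H.induce N).Adj ⟨_, m4⟩ ⟨_, m2⟩ := hH _ _ h3 (by simp [C_iff])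
  rw [SimpleGraph.connected_iff_exists_forall_reachable]
  refine ⟨⟨_, m1⟩, ?_⟩
  rintro ⟨u, hu⟩
  have := hu
  rw [hN, A_iff] at this
  rcases this with rfl | rfl | rfl | rfl
  · exact a1.reachable.symm
  · exact a2.reachable.symm
  · rfl
  · exact (a3.reachable.trans a1.reachable).symm

lemma edge_ncard (a b : V) (h : Q.A a b) :
    {p : V × Fin 4 | (Q.face p.1 p.2 = a ∧ Q.face p.1 (p.2 + 1) = b) ∨
        (Q.face p.1 p.2 = b ∧ Q.face p.1 (p.2 + 1) = a)}.ncard = 2 := by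
  have key1 : ∀ a b : V, b = Q.r a →
    {p : V × Fin 4 | (Q.face p.1 p.2 = a ∧ Q.face p.1 (p.2 + 1) = b) ∨
        (Q.face p.1 p.2 = b ∧ Q.face p.1 (p.2 + 1) = a)}.ncard = 2 := by
    rintro a b rfl
    obtain ⟨f, hf⟩ : ∃ f, ∀ g, ((Q.s (Q.r g) = a ∧ Q.s g = Q.r a) ∨
        (Q.s (Q.r g) = Q.r a ∧ Q.s g = a)) ↔ g = f := by
      have i1 := fun g h => Q.s_inj (a := g) (b := Q.t a) h
      have i2 := fun g h => Q.s_inj (a := Q.r g) (b := Q.t a) h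
      have i3 := Q.st a
      have i4 := Q.com (Q.t a)
      have i5 := Q.com (Q.r (Q.r (Q.t a)))
      have i6 := Q.r3
      have i7 := Q.rr2 a
      have i8 := Q.r3 a
      have i9 : Q.s (Q.r (Q.t a)) ≠ Q.s (Q.r (Q.r (Q.t a))) := fun h =>
          Q.rr2 _ (Q.s_inj h).symm
      by_cases hh : Q.s (Q.r (Q.t a)) = Q.r a
      · exact ⟨Q.t a, by grind⟩
      · refine ⟨Q.r (Q.r (Q.t a)), by grind⟩
    have hne : ((a, 0) : V × Fin 4) ≠ (f, 2) := by simp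
    rw [← Set.ncard_pair hne]
    congr 1; ext ⟨g, k⟩
    have := hf g
    have h1 := Q.rr1 a
    have h2 := Q.r1 a
    have h3 := Q.s0 g
    have h4 := Q.s1 g
    have h5 := Q.s2 g
    have h6 := Q.s0 (Q.r g)
    have h7 := Q.s1 (Q.r g)
    have h8 := Q.s2 (Q.r g)
    have h9 := Q.r3 g
    have h10 := Q.r3 a
    fin_cases k <;> simp <;> grind
  have key2 : ∀ a b : V, b = Q.s a →
    {p : V × Fin 4 | (Q.face p.1 p.2 = a ∧ Q.face p.1 (p.2 + 1) = b) ∨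
        (Q.face p.1 p.2 = b ∧ Q.face p.1 (p.2 + 1) = a)}.ncard = 2 := by
    rintro a b rfl
    have hne : ((a, 3) : V × Fin 4) ≠ (Q.r (Q.r a), 1) := by simp
    rw [← Set.ncard_pair hne]
    congr 1; ext ⟨g, k⟩
    have h0 := Q.ss0 a
    have h3 := Q.s0 a
    have h4 := Q.s1 a
    have h5 := Q.s2 a
    have h9 := Q.r3 g
    have h10 := Q.r3 a
    have h11 := Q.com g
    have h12 := Q.r3 (Q.s g)
    have h13 := Q.r3 (Q.s a)
    have h14 := Q.s1 (Q.r a)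
    have h15 := Q.s2 (Q.r a)
    fin_cases k <;> simp <;> grind
  have sw : ∀ a b : V, {p : V × Fin 4 | (Q.face p.1 p.2 = a ∧ Q.face p.1 (p.2 + 1) = b) ∨
        (Q.face p.1 p.2 = b ∧ Q.face p.1 (p.2 + 1) = a)} =
      {p : V × Fin 4 | (Q.face p.1 p.2 = b ∧ Q.face p.1 (p.2 + 1) = a) ∨
        (Q.face p.1 p.2 = a ∧ Q.face p.1 (p.2 + 1) = b)} := by
    intro a b; ext p; simp [or_comm]
  rcases h with h | h | h | h
  · exact key1 a b h
  · rw [sw]; exact key1 b a h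
  · exact key2 a b h
  · rw [sw]; exact key2 b a h

theorem embeds [Fintype V] [DecidableEq V] (G : SimpleGraph V) (hG : ∀ a b, G.Adj a b ↔ Q.A a b)
    (m : ℕ) (e : Fin m ≃ V) : IsQuadCellEmbedding G m (fun f => Q.face (e f)) := by
  have hC : ∀ v u w, Q.C v u w ↔ ∃ (f : Fin m) (k : Fin 4), Q.face (e f) (k + 1) = v ∧
            ((Q.face (e f) k = u ∧ Q.face (e f) (k + 2) = w) ∨
             (Q.face (e f) k = w ∧ Q.face (e f) (k + 2) = u)) := by
    intro v u w
    constructor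
    · rintro ⟨f, k, h⟩
      exact ⟨e.symm f, k, by simpa using h⟩
    · rintro ⟨f, k, h⟩
      exact ⟨e f, k, h⟩
  refine ⟨fun f k => (hG _ _).2 (Q.face_adj _ _), fun f => Q.face_inj _, ?_, ?_⟩
  · intro a b h
    rw [← Q.edge_ncard a b ((hG _ _).1 h)]
    exact Set.ncard_congr (fun p _ => (e p.1, p.2)) (fun p hp => hp)
      (by rintro ⟨p, k⟩ ⟨q, l⟩ _ _ h; simpa using h)
      (by rintro ⟨p, k⟩ h; exact ⟨(e.symm p, k), by simpa using h, by simp⟩)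
  · intro v
    constructor
    · apply Q.link_conn v _ (by simp [hG])
      intro u w huw h
      rw [hC] at h
      obtain ⟨f, k, h1, h2⟩ := h
      refine ⟨huw, ?_⟩
      rcases h2 with h2 | h2
      · exact Or.inl ⟨f, k, h1, h2⟩
      · exact Or.inr ⟨f, k, h1, h2⟩
    · intro u hu
      simp only [← hC, SimpleGraph.mem_neighborSet, hG] at hu ⊢
      exact Q.C_ncard v u hu

/-- an orientation comparison -/
lemma orient_ne (G : SimpleGraph V) (m : ℕ) (e : Fin m ≃ V) (ε : Fin m → Bool)
    (hε : ∀ a b : V, G.Adj a b →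
    ({p : Fin m × Fin 4 |
        if ε p.1 then Q.face (e p.1) p.2 = a ∧ Q.face (e p.1) (p.2 + 1) = b
        else Q.face (e p.1) p.2 = b ∧ Q.face (e p.1) (p.2 + 1) = a}).ncard = 1)
    (a b v w : V) (k l : Fin 4) (hab : G.Adj a b) (hkl : k ≠ l)
    (h1 : Q.face v k = a) (h2 : Q.face v (k+1) = b) :
    ((Q.face w l = b ∧ Q.face w (l+1) = a) → ε (e.symm v) = ε (e.symm w)) ∧
    ((Q.face w l = a ∧ Q.face w (l+1) = b) → ε (e.symm v) ≠ ε (e.symm w)) := by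
  have e1 := hε a b hab
  have e2 := hε b a hab.symm
  rw [Set.ncard_eq_one] at e1 e2
  obtain ⟨p, hp⟩ := e1
  obtain ⟨q, hq⟩ := e2
  rw [Set.ext_iff] at hp hq
  have p1 := hp (e.symm v, k)
  have p2 := hp (e.symm w, l)
  have q1 := hq (e.symm v, k)
  have q2 := hq (e.symm w, l)
  simp only [Set.mem_ofPred_eq, Set.mem_singleton_iff, Equiv.apply_symm_apply] at p1 p2 q1 q2
  constructor
  · rintro ⟨h3, h4⟩
    cases hv : ε (e.symm v) <;> cases hw : ε (e.symm w) <;> simp_all <;> grind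
  · rintro ⟨h3, h4⟩
    cases hv : ε (e.symm v) <;> cases hw : ε (e.symm w) <;> simp_all <;> grind

end QSys

def stepS (n : ℕ) (hn : 4 ≤ n) (v : Fin n × ZMod 3) : Fin n × ZMod 3 :=
  if h : v.1.1 + 1 < n then (⟨v.1.1 + 1, h⟩, v.2) else (⟨0, by omega⟩, -v.2)
def stepT (n : ℕ) (hn : 4 ≤ n) (v : Fin n × ZMod 3) : Fin n × ZMod 3 :=
  if h : v.1.1 = 0 then (⟨n - 1, by omega⟩, -v.2) else (⟨v.1.1 - 1, by omega⟩, v.2)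

def sysH (n : ℕ) (hn : 4 ≤ n) : QSys (Fin n × ZMod 3) where
  r v := (v.1, v.2 + 1)
  s := stepS n hn
  t := stepT n hn
  r3 := by
    rintro ⟨i, j⟩
    have h : j + 1 + 1 + 1 = j := by revert j; decide
    simp only [h]
  st := by
    rintro ⟨⟨i, hi⟩, j⟩
    unfold stepS stepT
    ext1 <;> grind
  ts := by
    rintro ⟨⟨i, hi⟩, j⟩
    unfold stepS stepT
    ext1 <;> grind
  com := by
    rintro ⟨⟨i, hi⟩, j⟩
    have : -(j + 1) = -j + 1 + 1 := by revert j; decide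
    unfold stepS
    grind
  r1 := by
    rintro ⟨i, j⟩ h
    have := congrArg Prod.snd h
    revert this; revert j; simp
  s0 := by rintro ⟨⟨i, hi⟩, j⟩; unfold stepS; grind
  s1 := by rintro ⟨⟨i, hi⟩, j⟩; unfold stepS; grind
  s2 := by rintro ⟨⟨i, hi⟩, j⟩; unfold stepS; grind
  ss0 := by rintro ⟨⟨i, hi⟩, j⟩; unfold stepS; grind
  ss1 := by rintro ⟨⟨i, hi⟩, j⟩; unfold stepS; grind
  ss2 := by rintro ⟨⟨i, hi⟩, j⟩; unfold stepS; grind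

lemma sysH_adj (n : ℕ) (hn : 4 ≤ n) (a b : Fin n × ZMod 3) :
    (Hgraph n).Adj a b ↔ (sysH n hn).A a b := by
  obtain ⟨⟨i, hi⟩, j⟩ := a
  obtain ⟨⟨i', hi'⟩, j'⟩ := b
  have h1 : j ≠ j' ↔ (j' = j + 1 ∨ j = j' + 1) := by revert j j'; decide
  have h2 : j' = -j ↔ j = -j' := by revert j j'; decide
  have h3 : j ≠ j + 1 := by simp
  have h4 : j' ≠ j' + 1 := by simp
  simp only [Hgraph, SimpleGraph.fromRel_adj, QSys.A, sysH, stepS]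
  grind

/-- For `n ≥ 4`, the 4-regular graph `H n` (with `3n` vertices and `6n` edges)
quadrangulates the Klein bottle: it has a 2-cell embedding with `3n`
quadrilateral faces — so the Euler characteristic of the underlying surface is
`3n - 6n + 3n = 0` — which is non-orientable; the closed surface with Euler
characteristic `0` that is non-orientable is the Klein bottle. -/
theorem Hgraph_quadrangulates_Klein_bottle (n : ℕ) (hn : 4 ≤ n) :
    ∃ face : Fin (3 * n) → Fin 4 → Fin n × ZMod 3,
      IsQuadCellEmbedding (Hgraph n) (3 * n) face ∧
        ¬ IsOrientableEmbedding (Hgraph n) (3 * n) face := by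
  have hcard : Fintype.card (Fin n × ZMod 3) = 3 * n := by
    simp [ZMod.card, mul_comm]
  let e : Fin (3 * n) ≃ Fin n × ZMod 3 := (Fintype.equivFinOfCardEq hcard).symm
  refine ⟨fun f => (sysH n hn).face (e f), (sysH n hn).embeds _ (sysH_adj n hn) _ e, ?_⟩
  rintro ⟨ε, hε⟩
  have key := (sysH n hn).orient_ne _ _ e ε hε
  have hor : ∀ v, ε (e.symm v) = ε (e.symm ((sysH n hn).r v)) := fun v =>
    (key ((sysH n hn).r v) ((sysH n hn).s ((sysH n hn).r v)) v ((sysH n hn).r v) 1 3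
      ((sysH_adj n hn _ _).2 (by simp [QSys.A])) (by decide) (by simp) (by simp)).1 (by simp)
  have hup : ∀ v, (sysH n hn).s ((sysH n hn).r v) = (sysH n hn).r ((sysH n hn).s v) →
      ε (e.symm v) = ε (e.symm ((sysH n hn).s v)) := fun v h =>
    (key ((sysH n hn).s ((sysH n hn).r v)) ((sysH n hn).s v) v ((sysH n hn).s v) 2 0
      ((sysH_adj n hn _ _).2 (by simp [QSys.A, h])) (by decide) (by simp) (by simp)).1 (by simp [h])
  have htw : ∀ v, (sysH n hn).s v = (sysH n hn).r ((sysH n hn).s ((sysH n hn).r v)) →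
      ε (e.symm v) ≠ ε (e.symm ((sysH n hn).s ((sysH n hn).r v))) := fun v h =>
    (key ((sysH n hn).s ((sysH n hn).r v)) ((sysH n hn).s v) v ((sysH n hn).s ((sysH n hn).r v))
      2 0 ((sysH_adj n hn _ _).2 (by simp [QSys.A, ← h])) (by decide) (by simp) (by simp)).2
      (by simp [← h])
  have hcol : ∀ i (hi : i < n), ε (e.symm (⟨i, hi⟩, 0)) = ε (e.symm (⟨0, by omega⟩, 0)) := by
    intro i
    induction i with
    | zero => intro hi; rfl
    | succ i ih =>
      intro hi
      rw [← ih (by omega)]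
      have := hup (⟨i, by omega⟩, 0) (by simp [sysH, stepS, hi])
      rw [this]
      simp [sysH, stepS, hi]
  have hlast : ¬ (n - 1 + 1 < n) := by omega
  have h1 := htw (⟨n - 1, by omega⟩, 0) (by simp [sysH, stepS, hlast])
  have h2 := hor (⟨0, by omega⟩, -1)
  rw [hcol] at h1
  simp [sysH, stepS, hlast] at h1 h2
  exact h1 h2.symm
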